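/- Let P ⊂ ℝ^d be a lattice zonotope and c ∈ ℚ^d. Then #((c + P) ∩ ℤ^d) ≤ #(P ∩ ℤ^d), and equality holds if and only if c ∈ ℤ^d. -/

import Mathlib

open Pointwise MeasureTheory
open scoped RealInnerProductSpace

noncomputable section

/-- Cast an integer vector to a real vector. -/
def castVec {d : ℕ} (x : Fin d → ℤ) : Fin d → ℝ := fun i => (x i : ℝ)

/-- Cast a rational vector to a real vector. -/
def ratVec {d : ℕ} (c : Fin d → ℚ) : Fin d → ℝ := fun i => (c i : ℝ)

/-- `den(c)`: the lcm of the denominators of the coordinates of a rational vector. -/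
def denv {d : ℕ} (c : Fin d → ℚ) : ℕ := Finset.univ.lcm fun i => (c i).den

/-- The number of lattice points in a subset of `ℝ^d`. -/
def latCount {d : ℕ} (S : Set (Fin d → ℝ)) : ℕ := {x : Fin d → ℤ | castVec x ∈ S}.ncard

/-- A lattice polytope: the convex hull of a nonempty finite set of integer points. -/
def IsLatticePolytope {d : ℕ} (P : Set (Fin d → ℝ)) : Prop :=
  ∃ V : Finset (Fin d → ℤ), V.Nonempty ∧ P = convexHull ℝ (castVec '' (V : Set (Fin d → ℤ)))

/-- The zonotope spanned by a finite set of integer vectors. -/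
def zonotopeF {d : ℕ} (U : Finset (Fin d → ℤ)) : Set (Fin d → ℝ) :=
  {x | ∃ lam : (Fin d → ℤ) → ℝ, (∀ u, lam u ∈ Set.Icc (0 : ℝ) 1) ∧
    x = ∑ u ∈ U, lam u • castVec u}

/-- The zonotope spanned by integer vectors `u 0, …, u (n-1)`. -/
def zonotopeZ {d n : ℕ} (u : Fin n → Fin d → ℤ) : Set (Fin d → ℝ) :=
  {x | ∃ lam : Fin n → ℝ, (∀ i, lam i ∈ Set.Icc (0 : ℝ) 1) ∧ x = ∑ i, lam i • castVec (u i)}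

/-- The zonotope spanned by real vectors `u 0, …, u (n-1)`. -/
def zonotopeR {d n : ℕ} (u : Fin n → Fin d → ℝ) : Set (Fin d → ℝ) :=
  {x | ∃ lam : Fin n → ℝ, (∀ i, lam i ∈ Set.Icc (0 : ℝ) 1) ∧ x = ∑ i, lam i • u i}

/-- A zonotope: a translate of the Minkowski sum of finitely many segments `[0, uᵢ]`. -/
def IsZonotope {d : ℕ} (P : Set (Fin d → ℝ)) : Prop :=
  ∃ (n : ℕ) (u : Fin n → Fin d → ℝ) (v : Fin d → ℝ), P = v +ᵥ zonotopeR u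

/-- A set is centrally symmetric if it is a translate of its negation. -/
def CentrallySymmetric {d : ℕ} (P : Set (Fin d → ℝ)) : Prop :=
  ∃ v : Fin d → ℝ, P = v +ᵥ (-P)

/-- `f` is a family of constituents of `L` with respect to the period `ρ`. -/
def IsConstituents (L : ℕ → ℚ) (ρ : ℕ) (f : ℕ → Polynomial ℚ) : Prop :=
  ∀ t : ℕ, 0 < t → L t = (f (t % ρ)).eval (t : ℚ)

/-- `ρ` is a period of the quasi-polynomial `L`. -/
def IsPeriodOf (ρ : ℕ) (L : ℕ → ℚ) : Prop := 0 < ρ ∧ ∃ f, IsConstituents L ρ f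

/-- `ρ₀` is the minimal period of the quasi-polynomial `L`. -/
def IsMinimalPeriodOf (ρ₀ : ℕ) (L : ℕ → ℚ) : Prop :=
  IsPeriodOf ρ₀ L ∧ ∀ ρ : ℕ, IsPeriodOf ρ L → ρ₀ ≤ ρ

/-- GCD-property with respect to the period `ρ`: constituents with equal
`gcd(ρ, ·)` coincide. -/
def GCDProperty (L : ℕ → ℚ) (ρ : ℕ) : Prop :=
  ∀ f : ℕ → Polynomial ℚ, IsConstituents L ρ f →
    ∀ k ℓ : ℕ, Nat.gcd ρ k = Nat.gcd ρ ℓ → f (k % ρ) = f (ℓ % ρ)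

/-- Symmetry with respect to the period `ρ`: `f_k = f_{ρ-k}` for `0 ≤ k ≤ ρ`. -/
def SymmetricQP (L : ℕ → ℚ) (ρ : ℕ) : Prop :=
  ∀ f : ℕ → Polynomial ℚ, IsConstituents L ρ f →
    ∀ k : ℕ, k ≤ ρ → f (k % ρ) = f ((ρ - k) % ρ)

/-- The Ehrhart counting function `t ↦ #(t(c + P) ∩ ℤ^d)` of the translate `c + P`. -/
def ehr {d : ℕ} (P : Set (Fin d → ℝ)) (c : Fin d → ℚ) : ℕ → ℚ :=
  fun t => (latCount ((t : ℝ) • (ratVec c +ᵥ P)) : ℚ)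

/-- The dimension of a polytope: the dimension of the direction of its affine hull. -/
def polyDim {d : ℕ} (P : Set (Fin d → ℝ)) : ℕ := Module.finrank ℝ (affineSpan ℝ P).direction

/-- `r` is the relative volume of `P` (of dimension `m`): with respect to any lattice
point `v₀` of `P` and any `ℤ`-basis `b` of the lattice `aff₀(P) ∩ ℤ^d`, `r` is the
Lebesgue measure of `P` in the coordinates determined by `v₀` and `b`. -/
def IsRelVolOf {d : ℕ} (P : Set (Fin d → ℝ)) (m : ℕ) (r : ℝ) : Prop :=
  ∀ (v₀ : Fin d → ℤ) (b : Fin m → Fin d → ℤ),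
    castVec v₀ ∈ P → LinearIndependent ℤ b →
    (∀ x : Fin d → ℤ,
      castVec x ∈ (affineSpan ℝ P).direction ↔ x ∈ Submodule.span ℤ (Set.range b)) →
    r = (volume {lam : Fin m → ℝ | castVec v₀ + ∑ i, lam i • castVec (b i) ∈ P}).toReal

/-- The (real casts of the) elements of `W` are linearly independent over `ℝ`. -/
def LinIndepF {d : ℕ} (W : Finset (Fin d → ℤ)) : Prop :=
  LinearIndependent ℝ fun w : ↥W => castVec w.1

/-- Almost locally constant: locally constant outside a discrete point set. -/
def AlmostLocallyConstant (f : ℝ → ℝ) : Prop :=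
  ∃ D : Set ℝ, DiscreteTopology D ∧ IsLocallyConstant fun x : ↥(Dᶜ) => f ↑x

/-- Almost constant: constant outside a discrete point set. -/
def AlmostConstant (f : ℝ → ℝ) : Prop :=
  ∃ D : Set ℝ, DiscreteTopology D ∧ ∃ r : ℝ, ∀ x ∉ D, f x = r

/-- The face of `P` in the outer normal direction `v`. -/
def normalFace {d : ℕ} (P : Set (EuclideanSpace ℝ (Fin d)))
    (v : EuclideanSpace ℝ (Fin d)) : Set (EuclideanSpace ℝ (Fin d)) :=
  {x | x ∈ P ∧ ∀ y ∈ P, ⟪y, v⟫ ≤ ⟪x, v⟫}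

/-- `F` is a facet of the `d`-polytope `P`: an exposed face of dimension `d - 1`. -/
def IsFacetOf {d : ℕ} (F P : Set (EuclideanSpace ℝ (Fin d))) : Prop :=
  (∃ v : EuclideanSpace ℝ (Fin d), v ≠ 0 ∧ F = normalFace P v) ∧
  Module.finrank ℝ (affineSpan ℝ F).direction = d - 1

section LatticeCounting

variable {A V : Type*} [AddCommGroup A] [AddCommGroup V] [Module ℝ V]

/-- The homomorphism `A ⧸ ℤw → V ⧸ ℝφ(w)` induced by `φ : A → V`. -/
def quotientSpanHom (φ : A →+ V) (w : A) :
    A ⧸ AddSubgroup.zmultiples w →+ V ⧸ Submodule.span ℝ {φ w} :=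
  QuotientAddGroup.lift _ ((Submodule.mkQ (Submodule.span ℝ {φ w})).toAddMonoidHom.comp φ) <| by
    rw [AddSubgroup.zmultiples_le]
    simp [AddMonoidHom.mem_ker, Submodule.mem_span_singleton_self]

@[simp]
lemma quotientSpanHom_mk (φ : A →+ V) (w a : A) :
    quotientSpanHom φ w (QuotientAddGroup.mk a) = Submodule.mkQ (Submodule.span ℝ {φ w}) (φ a) :=
  rfl

lemma mem_segment_zero_add {v x : V} {S : Set V} :
    x ∈ segment ℝ 0 v + S ↔ ∃ t : ℝ, 0 ≤ t ∧ t ≤ 1 ∧ x - t • v ∈ S := by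
  simp only [Set.mem_add, segment_eq_image', Set.mem_image, Set.mem_Icc]
  constructor
  · rintro ⟨_, ⟨t, ⟨h0, h1⟩, rfl⟩, s, hs, rfl⟩
    exact ⟨t, h0, h1, by simpa using hs⟩
  · rintro ⟨t, h0, h1, h⟩
    exact ⟨t • v, ⟨t, ⟨h0, h1⟩, by simp⟩, _, h, by simp⟩

/-- If `x` lies just outside a convex set `S` in direction `v`, then moving on by a positive integer
multiple of `v` leaves `[0, v] + S`. -/
lemma add_zsmul_notMem_segment_add {v x : V} {S : Set V} (hS : Convex ℝ S)
    (hx : x ∈ segment ℝ 0 v + S) (hxS : x ∉ S) {k : ℤ} (hk : 1 ≤ k) :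
    x + k • v ∉ segment ℝ 0 v + S := by
  intro h
  obtain ⟨t, ht0, -, hs⟩ := mem_segment_zero_add.1 hx
  obtain ⟨t', -, ht1', hs'⟩ := mem_segment_zero_add.1 h
  have hk' : (1 : ℝ) ≤ k := by exact_mod_cast hk
  rw [← Int.cast_smul_eq_zsmul ℝ] at hs'
  rcases ht0.eq_or_lt with rfl | htpos
  · exact hxS (by simpa using hs)
  have hpos : 0 < (k : ℝ) - t' + t := by linarith
  apply hxS
  have hmem := hS hs hs' (a := (k - t') / (k - t' + t)) (b := t / (k - t' + t))
    (div_nonneg (by linarith) hpos.le) (div_nonneg ht0 hpos.le)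
    (by rw [← add_div, div_self hpos.ne'])
  convert hmem using 1
  match_scalars <;> field_simp
  ring

/-- Lattice points of `[0, φ w] + S` are those of `S` together with one for each point of the
quotient lattice lying in the projection of `S` along `φ w`. -/
lemma encard_preimage_segment_add (φ : A →+ V) (w : A) {S : Set V} (hS : Convex ℝ S)
    (hbdd : ∀ x, ∃ k : ℕ, x + k • φ w ∉ S) :
    (φ ⁻¹' (segment ℝ 0 (φ w) + S)).encard = (φ ⁻¹' S).encard +
      (quotientSpanHom φ w ⁻¹' (Submodule.mkQ (Submodule.span ℝ {φ w}) '' S)).encard := by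
  set T := segment ℝ 0 (φ w) + S
  have hST : S ⊆ T := fun x hx => mem_segment_zero_add.2 ⟨0, le_rfl, zero_le_one, by simpa using hx⟩
  have hinj : Set.InjOn (QuotientAddGroup.mk : A → A ⧸ AddSubgroup.zmultiples w)
      (φ ⁻¹' (T \ S)) := by
    intro a ha b hb hab
    obtain ⟨k, hk⟩ := AddSubgroup.mem_zmultiples_iff.1 (QuotientAddGroup.eq.1 hab)
    obtain rfl : b = a + k • w := by rw [hk]; abel
    rcases lt_trichotomy k 0 with hneg | rfl | hpos
    · refine absurd ha.1 ?_
      have := add_zsmul_notMem_segment_add hS hb.1 hb.2 (k := -k) (by omega)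
      simpa using this
    · simp
    · refine absurd hb.1 ?_
      simpa using add_zsmul_notMem_segment_add hS ha.1 ha.2 (k := k) (by omega)
  have himage : (QuotientAddGroup.mk : A → A ⧸ AddSubgroup.zmultiples w) '' (φ ⁻¹' (T \ S)) =
      quotientSpanHom φ w ⁻¹' (Submodule.mkQ (Submodule.span ℝ {φ w}) '' S) := by
    apply Set.Subset.antisymm
    · rintro _ ⟨a, ha, rfl⟩
      obtain ⟨t, -, -, hs⟩ := mem_segment_zero_add.1 ha.1
      refine ⟨_, hs, ?_⟩
      rw [quotientSpanHom_mk, Submodule.mkQ_apply, Submodule.mkQ_apply, Submodule.Quotient.eq,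
        Submodule.mem_span_singleton]
      exact ⟨-t, by simp⟩
    · intro q
      obtain ⟨a, rfl⟩ := QuotientAddGroup.mk_surjective q
      rintro ⟨x, hx, hxa⟩
      rw [quotientSpanHom_mk, Submodule.mkQ_apply, Submodule.mkQ_apply, eq_comm,
        Submodule.Quotient.eq, Submodule.mem_span_singleton] at hxa
      obtain ⟨t, ht⟩ := hxa
      have hbT : φ (a - ⌊t⌋ • w) ∈ T := by
        refine mem_segment_zero_add.2 ⟨Int.fract t, Int.fract_nonneg t, (Int.fract_lt_one t).le, ?_⟩
        convert hx using 1
        rw [map_sub, map_zsmul, ← Int.cast_smul_eq_zsmul ℝ, sub_sub, ← add_smul,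
          Int.floor_add_fract, ht, sub_sub_cancel]
      classical
      have hk := Nat.find_spec (hbdd (φ (a - ⌊t⌋ • w)))
      have hmin := fun m => Nat.find_min (hbdd (φ (a - ⌊t⌋ • w))) (m := m)
      set k := Nat.find (hbdd (φ (a - ⌊t⌋ • w)))
      refine ⟨a - ⌊t⌋ • w + k • w, ⟨?_, by simpa only [map_add, map_nsmul] using hk⟩, ?_⟩
      · rcases Nat.eq_zero_or_pos k with h0 | hpos
        · simpa [h0] using hbT
        · have := not_not.1 (hmin (k - 1) (by omega))
          refine mem_segment_zero_add.2 ⟨1, zero_le_one, le_rfl, ?_⟩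
          convert this using 1
          obtain ⟨m, hm⟩ : ∃ m, k = m + 1 := ⟨k - 1, by omega⟩
          rw [hm, map_add, map_nsmul, add_smul, one_smul, one_smul, Nat.add_sub_cancel,
            ← add_assoc, add_sub_cancel_right]
      · refine QuotientAddGroup.eq.2 (AddSubgroup.mem_zmultiples_iff.2 ⟨⌊t⌋ - k, ?_⟩)
        rw [sub_smul, natCast_zsmul]
        abel
  rw [← himage, hinj.encard_image, ← Set.encard_union_eq, ← Set.preimage_union,
    Set.union_sdiff_cancel hST]
  exact Disjoint.preimage _ Set.disjoint_sdiff_right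

lemma bddAbove_image_sum_segment {ι : Type*} (s : Finset ι) (v : ι → V) (f : V →ₗ[ℝ] ℝ) :
    BddAbove (f '' ∑ i ∈ s, segment ℝ 0 (v i)) := by
  rw [Set.image_finsetSum]
  refine Finset.sum_induction _ BddAbove (fun _ _ => BddAbove.add) bddAbove_singleton fun i _ => ?_
  have := image_segment ℝ f.toAffineMap 0 (v i)
  simp only [LinearMap.coe_toAffineMap] at this
  rw [this, segment_eq_uIcc]
  exact bddAbove_Icc

lemma exists_add_nsmul_notMem_vadd_sum_segment {ι : Type*} (s : Finset ι) (v : ι → V) {w : V}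
    (hw : w ≠ 0) (c x : V) : ∃ k : ℕ, x + k • w ∉ c +ᵥ ∑ i ∈ s, segment ℝ 0 (v i) := by
  obtain ⟨f, hf⟩ := Module.Projective.exists_dual_eq_one ℝ hw
  obtain ⟨B, hB⟩ := bddAbove_image_sum_segment s v f
  obtain ⟨k, hk⟩ := exists_nat_gt (B + f c - f x)
  refine ⟨k, fun hmem => ?_⟩
  obtain ⟨y, hy, hyx⟩ := hmem
  have h1 : f y ≤ B := hB ⟨y, hy, rfl⟩
  have h2 : f c + f y = f x + k := by
    simpa [hf] using congrArg f hyx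
  linarith

/-- Translating a lattice zonotope does not increase its number of lattice points, and preserves it
(when it is finite) only for translations by lattice vectors. Here lattice points are counted
through an arbitrary homomorphism `φ`, which makes the statement stable under quotients. -/
theorem encard_preimage_vadd_sum_segment_le {ι : Type*} (s : Finset ι) :
    ∀ {A V : Type} [AddCommGroup A] [AddCommGroup V] [Module ℝ V] (φ : A →+ V) (u : ι → A) (c : V),
      (φ ⁻¹' (c +ᵥ ∑ i ∈ s, segment ℝ 0 (φ (u i)))).encard ≤
        (φ ⁻¹' (∑ i ∈ s, segment ℝ 0 (φ (u i)))).encard ∧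
      ((φ ⁻¹' (∑ i ∈ s, segment ℝ 0 (φ (u i)))).Finite →
        (φ ⁻¹' (c +ᵥ ∑ i ∈ s, segment ℝ 0 (φ (u i)))).encard =
          (φ ⁻¹' (∑ i ∈ s, segment ℝ 0 (φ (u i)))).encard → c ∈ Set.range φ) := by
  classical
  induction s using Finset.induction_on with
  | empty =>
    intro A V _ _ _ φ u c
    have h0 : (0 : A) ∈ φ ⁻¹' (0 : Set V) := by simp
    simp only [Finset.sum_empty]
    by_cases hc : c ∈ Set.range φ
    · obtain ⟨a, rfl⟩ := hc
      refine ⟨le_of_eq ?_, fun _ _ => ⟨a, rfl⟩⟩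
      rw [← (add_right_injective a).encard_image (φ ⁻¹' 0)]
      congr 1
      ext b
      simp only [Set.mem_preimage, Set.mem_vadd_set, Set.mem_zero, exists_eq_left, vadd_eq_add,
        add_zero, Set.mem_image]
      constructor
      · intro h
        exact ⟨b - a, by simp [h], by abel⟩
      · rintro ⟨x, hx, rfl⟩
        simp [hx]
    · have hempty : φ ⁻¹' (c +ᵥ (0 : Set V)) = ∅ := by
        ext b
        simp only [Set.mem_preimage, Set.mem_vadd_set, Set.mem_zero, exists_eq_left, vadd_eq_add,
          add_zero, Set.mem_empty_iff_false, iff_false]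
        exact fun h => hc ⟨b, h.symm⟩
      rw [hempty]
      refine ⟨by simp, fun _ h => ?_⟩
      rw [Set.encard_empty, eq_comm, Set.encard_eq_zero] at h
      exact absurd (h ▸ h0) (Set.notMem_empty _)
  | insert j s hj ih =>
    intro A V _ _ _ φ u c
    rw [Finset.sum_insert hj]
    by_cases hw : φ (u j) = 0
    · simpa [hw] using ih φ u c
    set Z := ∑ i ∈ s, segment ℝ 0 (φ (u i))
    have hZ : Convex ℝ Z := convex_sum _ fun i _ => convex_segment _ _
    have hcount := encard_preimage_segment_add φ (u j) (hZ.vadd c)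
      (exists_add_nsmul_notMem_vadd_sum_segment s _ hw c)
    have hcount₀ := encard_preimage_segment_add φ (u j) hZ fun x => by
      simpa using exists_add_nsmul_notMem_vadd_sum_segment s (fun i => φ (u i)) hw 0 x
    have himage : Submodule.mkQ (Submodule.span ℝ {φ (u j)}) '' Z =
        ∑ i ∈ s, segment ℝ 0 (quotientSpanHom φ (u j) (QuotientAddGroup.mk (u i))) := by
      rw [Set.image_finsetSum]
      refine Finset.sum_congr rfl fun i _ => ?_
      simpa using image_segment ℝ
        (Submodule.mkQ (Submodule.span ℝ {φ (u j)})).toAffineMap 0 (φ (u i))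
    have himage_vadd : Submodule.mkQ (Submodule.span ℝ {φ (u j)}) '' (c +ᵥ Z) =
        Submodule.mkQ (Submodule.span ℝ {φ (u j)}) c +ᵥ
          Submodule.mkQ (Submodule.span ℝ {φ (u j)}) '' Z := by
      simp only [← Set.image_vadd, Set.image_image, vadd_eq_add, map_add]
    have hcomm : c +ᵥ (segment ℝ 0 (φ (u j)) + Z) = segment ℝ 0 (φ (u j)) + (c +ᵥ Z) :=
      (add_vadd_comm _ _ _).symm
    rw [himage_vadd, himage] at hcount
    rw [himage] at hcount₀
    rw [hcomm, hcount, hcount₀]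
    obtain ⟨hle, heq⟩ := ih φ u c
    have hle' := (ih (quotientSpanHom φ (u j)) (fun i => QuotientAddGroup.mk (u i))
      (Submodule.mkQ (Submodule.span ℝ {φ (u j)}) c)).1
    refine ⟨add_le_add hle hle', fun hfin h => ?_⟩
    rw [← Set.encard_ne_top_iff, hcount₀] at hfin
    obtain ⟨hfin₁, hfin₂⟩ := WithTop.add_ne_top.1 hfin
    refine heq (Set.encard_ne_top_iff.1 hfin₁) (hle.antisymm ?_)
    exact (ENat.add_le_add_iff_right hfin₂).1 (h.symm.le.trans (add_le_add_right hle' _))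

end LatticeCounting

/-- `castVec` as an additive homomorphism. -/
def castVecHom (d : ℕ) : (Fin d → ℤ) →+ (Fin d → ℝ) where
  toFun := castVec
  map_zero' := by ext; simp [castVec]
  map_add' x y := by ext; simp [castVec]

lemma zonotopeZ_eq_sum_segment {d n : ℕ} (u : Fin n → Fin d → ℤ) :
    zonotopeZ u = ∑ i, segment ℝ 0 (castVecHom d (u i)) := by
  rw [← parallelepiped_eq_sum_segment fun i => castVecHom d (u i)]
  ext x
  rw [mem_parallelepiped_iff]
  simp only [zonotopeZ, Set.mem_ofPred_eq, Set.mem_Icc, Pi.le_def, ← forall_and]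
  rfl

lemma finite_castVec_mem_zonotopeZ {d n : ℕ} (u : Fin n → Fin d → ℤ) :
    {x : Fin d → ℤ | castVec x ∈ zonotopeZ u}.Finite := by
  refine (Set.finite_Icc (-∑ i, |u i|) (∑ i, |u i|)).subset ?_
  rintro x ⟨t, ht, hx⟩
  suffices h : ∀ j, |x j| ≤ (∑ i, |u i|) j from
    ⟨fun j => (abs_le.1 (h j)).1, fun j => (abs_le.1 (h j)).2⟩
  intro j
  have hj : (x j : ℝ) = ∑ i, t i * (u i j : ℝ) := by
    simpa [castVec] using congrFun hx j
  have : |(x j : ℝ)| ≤ ∑ i, |(u i j : ℝ)| := by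
    rw [hj]
    refine (Finset.abs_sum_le_sum_abs _ _).trans (Finset.sum_le_sum fun i _ => ?_)
    rw [abs_mul, abs_of_nonneg (ht i).1]
    exact mul_le_of_le_one_left (abs_nonneg _) (ht i).2
  simp only [Pi.abs_apply, Finset.sum_apply]
  exact_mod_cast this

lemma latCount_castVec_vadd {d : ℕ} (z : Fin d → ℤ) (S : Set (Fin d → ℝ)) :
    latCount (castVec z +ᵥ S) = latCount S := by
  unfold latCount
  rw [← Set.ncard_image_of_injective {x | castVec x ∈ S} (add_right_injective z)]
  congr 1
  ext x
  have : castVec (-z + x) = -castVec z + castVec x := by ext; simp [castVec]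
  simp [Set.mem_vadd_set_iff_neg_vadd_mem, this]

/-- For a lattice zonotope `P = Z(u₁,…,uₙ)` and `c ∈ ℚ^d`,
`#((c + P) ∩ ℤ^d) ≤ #(P ∩ ℤ^d)`, with equality iff `c ∈ ℤ^d`. -/
theorem latCount_translate_le_of_zonotope
    (d n : ℕ) (u : Fin n → Fin d → ℤ) (c : Fin d → ℚ) :
    latCount (ratVec c +ᵥ zonotopeZ u) ≤ latCount (zonotopeZ u) ∧
    (latCount (ratVec c +ᵥ zonotopeZ u) = latCount (zonotopeZ u) ↔
      ∃ z : Fin d → ℤ, ratVec c = castVec z) := by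
  have hfin := finite_castVec_mem_zonotopeZ u
  obtain ⟨hle, heq⟩ :=
    encard_preimage_vadd_sum_segment_le Finset.univ (castVecHom d) u (ratVec c)
  rw [← zonotopeZ_eq_sum_segment] at hle heq
  have hfin' : {x : Fin d → ℤ | castVec x ∈ ratVec c +ᵥ zonotopeZ u}.Finite :=
    Set.encard_lt_top_iff.1 (hle.trans_lt (Set.encard_lt_top_iff.2 hfin))
  refine ⟨ENat.toNat_le_toNat hle hfin.encard_lt_top.ne, fun h => ?_, ?_⟩
  · obtain ⟨z, hz⟩ := heq hfin (by
      change {x : Fin d → ℤ | castVec x ∈ _}.encard = {x : Fin d → ℤ | castVec x ∈ _}.encard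
      rw [← hfin'.cast_ncard_eq, ← hfin.cast_ncard_eq]
      exact congrArg _ h)
    exact ⟨z, hz.symm⟩
  · rintro ⟨z, hz⟩
    rw [hz, latCount_castVec_vadd]
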